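/- arXiv:2306.12948 — 5 statements merged into one kernel-verified Lean document; each statement's English description precedes it below -/
import Mathlib

section
/- Let F be any field and let s, t be positive integers. In the field F(X,Y) of rational functions in two variables, with binomial coefficients regarded in F via the natural map from the integers, one has 1/(X^s Y^t) = Σ_{i+j=s+t, i,j ≥ 1} [ C(j−1, t−1)/(X^i (X+Y)^j) + C(j−1, s−1)/(Y^i (X+Y)^j) ], where the sum is over all pairs of positive integers (i, j) with i + j = s + t. -/
/-!
STATEMENT 0: For any field `F` and positive integers `s, t`, in the field
`F(X,Y)` of rational functions in two variables (realized as the fraction field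
of `MvPolynomial (Fin 2) F`), one has
`1/(X^s Y^t) = Σ_{i+j=s+t, i,j ≥ 1} [ C(j−1,t−1)/(X^i (X+Y)^j) + C(j−1,s−1)/(Y^i (X+Y)^j) ]`,
where the sum over pairs of positive integers `(i,j)` with `i + j = s + t` is
parametrized by `j ∈ [1, s+t-1]`, `i = s+t-j`, and the binomial coefficients are
regarded in `F` (hence in `F(X,Y)`) via the natural map from `ℕ`.
-/

open scoped BigOperators

/-- The part of the partial fraction expansion of `u ^ (a + 1) * v ^ (b + 1)` that involves `u`. -/
def partialFractionSum {R : Type*} [CommRing R] (u w : R) (a b : ℕ) : R :=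
  ∑ k ∈ Finset.range (a + b + 1), (k.choose b : R) * (u ^ (a + b + 1 - k) * w ^ (k + 1))

section PartialFractionSum

variable {R : Type*} [CommRing R] (u w : R)

theorem partialFractionSum_zero_left (b : ℕ) :
    partialFractionSum u w 0 b = u * w ^ (b + 1) := by
  unfold partialFractionSum
  rw [Finset.sum_range_succ, Finset.sum_eq_zero]
  · simp
  · intro k hk
    rw [Nat.choose_eq_zero_of_lt (by simpa using hk)]
    simp

theorem partialFractionSum_succ_zero (a : ℕ) :
    partialFractionSum u w (a + 1) 0 = w * (u ^ (a + 2) + partialFractionSum u w a 0) := by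
  unfold partialFractionSum
  rw [Finset.sum_range_succ', mul_add, Finset.mul_sum, add_comm]
  congr 1
  · simp
    ring
  · refine Finset.sum_congr rfl fun k _ => ?_
    rw [show a + 1 + 0 + 1 - (k + 1) = a + 0 + 1 - k by omega]
    simp only [Nat.choose_zero_right]
    ring

theorem partialFractionSum_succ_succ (a b : ℕ) :
    partialFractionSum u w (a + 1) (b + 1) =
      w * (partialFractionSum u w a (b + 1) + partialFractionSum u w (a + 1) b) := by
  unfold partialFractionSum
  rw [Finset.sum_range_succ', show a + 1 + b + 1 = a + (b + 1) + 1 by ring,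
    ← Finset.sum_add_distrib, Finset.mul_sum]
  simp only [Nat.choose_zero_succ, Nat.cast_zero, zero_mul, add_zero]
  refine Finset.sum_congr (by congr 1; ring) fun k _ => ?_
  rw [show a + 1 + (b + 1) + 1 - (k + 1) = a + (b + 1) + 1 - k by omega, Nat.choose_succ_succ]
  push_cast
  ring

/-- Partial fraction expansion for elements that behave like `1 / x`, `1 / y`, `1 / (x + y)`. -/
theorem pow_succ_mul_pow_succ_eq_partialFractionSum {u v w : R} (h : u * v = w * (u + v))
    (a b : ℕ) :
    u ^ (a + 1) * v ^ (b + 1) = partialFractionSum u w a b + partialFractionSum v w b a := by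
  induction a generalizing b with
  | zero =>
    induction b with
    | zero =>
      simp only [partialFractionSum_zero_left]
      linear_combination h
    | succ b ih =>
      rw [partialFractionSum_succ_zero, partialFractionSum_zero_left]
      rw [partialFractionSum_zero_left] at ih
      linear_combination v ^ (b + 1) * h + w * ih
  | succ a iha =>
    induction b with
    | zero =>
      have ih := iha 0
      rw [partialFractionSum_zero_left] at ih
      rw [partialFractionSum_succ_zero, partialFractionSum_zero_left]
      linear_combination u ^ (a + 1) * h + w * ih
    | succ b ihb =>
      rw [partialFractionSum_succ_succ, partialFractionSum_succ_succ]
      linear_combination u ^ (a + 1) * v ^ (b + 1) * h + w * iha (b + 1) + w * ihb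

end PartialFractionSum

/-- Partial fraction expansion of `1 / (x ^ s * y ^ t)` in a field. -/
theorem one_div_pow_mul_pow_eq_sum {K : Type*} [Field K] {x y : K} (hx : x ≠ 0) (hy : y ≠ 0)
    (hxy : x + y ≠ 0) {s t : ℕ} (hs : 1 ≤ s) (ht : 1 ≤ t) :
    1 / (x ^ s * y ^ t) =
      ∑ j ∈ Finset.Icc 1 (s + t - 1),
        (((j - 1).choose (t - 1) : K) / (x ^ (s + t - j) * (x + y) ^ j) +
          ((j - 1).choose (s - 1) : K) / (y ^ (s + t - j) * (x + y) ^ j)) := by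
  obtain ⟨a, rfl⟩ := Nat.exists_eq_add_of_le' hs
  obtain ⟨b, rfl⟩ := Nat.exists_eq_add_of_le' ht
  have h : x⁻¹ * y⁻¹ = (x + y)⁻¹ * (x⁻¹ + y⁻¹) := by
    field_simp
    ring
  have key := pow_succ_mul_pow_succ_eq_partialFractionSum h a b
  unfold partialFractionSum at key
  rw [add_comm b a, ← Finset.sum_add_distrib] at key
  rw [one_div, mul_inv, ← inv_pow, ← inv_pow, key, ← Finset.Ico_add_one_right_eq_Icc,
    Finset.sum_Ico_eq_sum_range]
  refine Finset.sum_congr (by congr 1; omega) fun k _ => ?_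
  rw [show a + 1 + (b + 1) - (1 + k) = a + b + 1 - k by omega, add_comm 1 k]
  simp only [Nat.add_sub_cancel, div_eq_mul_inv, mul_inv, inv_pow]

theorem statement0 (F : Type*) [Field F] (s t : ℕ) (hs : 1 ≤ s) (ht : 1 ≤ t)
    (X Y : FractionRing (MvPolynomial (Fin 2) F))
    (hX : X = algebraMap (MvPolynomial (Fin 2) F) _ (MvPolynomial.X 0))
    (hY : Y = algebraMap (MvPolynomial (Fin 2) F) _ (MvPolynomial.X 1)) :
    1 / (X ^ s * Y ^ t) =
      ∑ j ∈ Finset.Icc 1 (s + t - 1),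
        (((j - 1).choose (t - 1) : FractionRing (MvPolynomial (Fin 2) F)) /
            (X ^ (s + t - j) * (X + Y) ^ j) +
          ((j - 1).choose (s - 1) : FractionRing (MvPolynomial (Fin 2) F)) /
            (Y ^ (s + t - j) * (X + Y) ^ j)) := by
  have inj := IsFractionRing.injective (MvPolynomial (Fin 2) F)
    (FractionRing (MvPolynomial (Fin 2) F))
  have hXY : (MvPolynomial.X 0 + MvPolynomial.X 1 : MvPolynomial (Fin 2) F) ≠ 0 := by
    intro h
    simpa using congrArg (MvPolynomial.eval ![(1 : F), 0]) h
  subst hX hY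
  refine one_div_pow_mul_pow_eq_sum ?_ ?_ ?_ hs ht
  · exact (map_ne_zero_iff _ inj).mpr (MvPolynomial.X_ne_zero 0)
  · exact (map_ne_zero_iff _ inj).mpr (MvPolynomial.X_ne_zero 1)
  · rw [← map_add]
    exact (map_ne_zero_iff _ inj).mpr hXY
end

section
/- Let 𝙰, 𝙱 be admissible arrays which are compositions of (Σ_1, w_1) and (Σ_2, w_2) respectively, where Σ_1, Σ_2 are finite weighted subsets of ℕ* and w_1, w_2 are positive integers. Then there exist finitely many elements α_1,…,α_m ∈ F_q and admissible arrays 𝙲_1,…,𝙲_m, each a composition of (Σ_1 ⊔ Σ_2, w_1 + w_2), all independent of d, such that for all d ∈ ℕ: S_d(𝙰) · S_d(𝙱) = Σ_{i=1}^{m} α_i S_d(𝙲_i). -/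
/-!
STATEMENT 5: Let `𝙰, 𝙱` be admissible arrays which are compositions of
`(Σ₁, w₁)` and `(Σ₂, w₂)` respectively.  Then there exist finitely many
`α_1,…,α_m ∈ F_q` and admissible arrays `𝙲_1,…,𝙲_m`, each a composition of
`(Σ₁ ⊔ Σ₂, w₁ + w₂)`, all independent of `d`, such that for all `d ∈ ℕ`:
`S_d(𝙰)·S_d(𝙱) = Σ_i α_i S_d(𝙲_i)` in the polynomial ring over `K = F_q(θ)`
in the indeterminates `t_n`.
-/

open Polynomial Finset

noncomputable section

variable (Fq : Type) [Field Fq] [Fintype Fq]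

/-- The monic polynomial `θ^d + Σ_{i<d} c_i θ^i`; as `c` ranges over `Fin d → Fq`
these are exactly the elements of `A^+(d)`. -/
def mP (d : ℕ) (c : Fin d → Fq) : Polynomial Fq :=
  Polynomial.X ^ d + ∑ i : Fin d, Polynomial.C (c i) * Polynomial.X ^ (i : ℕ)

/-- `a` as an element of `K`. -/
def aK (a : Polynomial Fq) : RatFunc Fq := algebraMap (Polynomial Fq) (RatFunc Fq) a

/-- The canonical map `F_q → K`. -/
def FqK : Fq →+* RatFunc Fq :=
  (algebraMap (Polynomial Fq) (RatFunc Fq)).comp Polynomial.C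

/-- `a(t_n)`: substitute `θ` by the indeterminate `t_n` in `a ∈ A`. -/
def tval (n : ℕ+) (a : Polynomial Fq) : MvPolynomial ℕ+ (RatFunc Fq) :=
  Polynomial.eval₂ ((MvPolynomial.C : RatFunc Fq →+* MvPolynomial ℕ+ (RatFunc Fq)).comp (FqK Fq))
    (MvPolynomial.X n) a

/-- The character `χ_Σ(a) = ∏_n a(t_n)^{σ_n}` of a finite weighted subset. -/
def chiW (Sg : ℕ+ →₀ ℕ) (a : Polynomial Fq) : MvPolynomial ℕ+ (RatFunc Fq) :=
  Sg.prod fun n e => (tval Fq n a) ^ e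

/-- The depth-one power sum `S_d(Σ; s) = Σ_{a ∈ A^+(d)} χ_Σ(a)/a^s`. -/
def S1 (d : ℕ) (Sg : ℕ+ →₀ ℕ) (s : ℕ) : MvPolynomial ℕ+ (RatFunc Fq) :=
  ∑ c : Fin d → Fq, chiW Fq Sg (mP Fq d c) * MvPolynomial.C ((aK Fq (mP Fq d c)) ^ s)⁻¹

/-- Power sums of arrays, encoded as lists of pairs `(Σ_i, s_i)`:
`S_d(𝙰) = Σ_{d = d_1 > … > d_r ≥ 0} ∏_i S_{d_i}(Σ_i; s_i)`. -/
def SP : List ((ℕ+ →₀ ℕ) × ℕ) → ℕ → MvPolynomial ℕ+ (RatFunc Fq)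
  | [], d => if d = 0 then 1 else 0
  | [x], d => S1 Fq d x.1 x.2
  | x :: y :: L, d => S1 Fq d x.1 x.2 * ∑ k ∈ Finset.range d, SP (y :: L) k

/-- `𝙰` is an admissible array which is a composition of `(Σ, w)`: all exponents
are positive, the types add up (pointwise) to `Σ` and the exponents add up to `w`. -/
def IsCompW (L : List ((ℕ+ →₀ ℕ) × ℕ)) (Sg : ℕ+ →₀ ℕ) (w : ℕ) : Prop :=
  (∀ x ∈ L, 1 ≤ x.2) ∧ (L.map Prod.fst).sum = Sg ∧ (L.map Prod.snd).sum = w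

/-- The finset `A^+(d)` of monic polynomials of degree `d`. -/
def monicFinset (d : ℕ) : Finset (Polynomial Fq) :=
  letI := Classical.decEq (Polynomial Fq)
  Finset.univ.image (mP Fq d)

/-- The summand `χ_Σ(a) / a^s` of a depth-one power sum. -/
def summand (x : (ℕ+ →₀ ℕ) × ℕ) (a : Polynomial Fq) : MvPolynomial ℕ+ (RatFunc Fq) :=
  chiW Fq x.1 a * MvPolynomial.C ((aK Fq a) ^ x.2)⁻¹

/-- The depth-one power sum as a function of the degree. -/
def depthOne (x : (ℕ+ →₀ ℕ) × ℕ) : ℕ → MvPolynomial ℕ+ (RatFunc Fq) :=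
  fun d => S1 Fq d x.1 x.2

/-- The summation operator `f ↦ (d ↦ ∑_{k < d} f k)`. -/
def sumLT : (ℕ → MvPolynomial ℕ+ (RatFunc Fq)) →ₗ[Fq] (ℕ → MvPolynomial ℕ+ (RatFunc Fq)) where
  toFun f d := ∑ k ∈ Finset.range d, f k
  map_add' f g := by ext1 d; simp [Finset.sum_add_distrib]
  map_smul' c f := by ext1 d; simp [Finset.smul_sum]

/-- The truncated sums `S_{<d}(𝙰)`, with the value `1` for the empty array. -/
def truncSum : List ((ℕ+ →₀ ℕ) × ℕ) → ℕ → MvPolynomial ℕ+ (RatFunc Fq)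
  | [] => 1
  | x :: L => sumLT Fq (depthOne Fq x * truncSum L)

/-- The span of the power sums of nonempty admissible arrays of total type `g`. -/
def powerSpan (g : (ℕ+ →₀ ℕ) × ℕ) : Submodule Fq (ℕ → MvPolynomial ℕ+ (RatFunc Fq)) :=
  Submodule.span Fq {f | ∃ (x : (ℕ+ →₀ ℕ) × ℕ) (L : List ((ℕ+ →₀ ℕ) × ℕ)),
    (∀ y ∈ x :: L, 1 ≤ y.2) ∧ (x :: L).sum = g ∧ depthOne Fq x * truncSum Fq L = f}

/-- The span of the truncated sums of admissible arrays of total type `g`. -/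
def truncSpan (g : (ℕ+ →₀ ℕ) × ℕ) : Submodule Fq (ℕ → MvPolynomial ℕ+ (RatFunc Fq)) :=
  Submodule.span Fq {f | ∃ L : List ((ℕ+ →₀ ℕ) × ℕ),
    (∀ y ∈ L, 1 ≤ y.2) ∧ L.sum = g ∧ truncSum Fq L = f}

/-- Sums over pairs of distinct monic polynomials of degree `d`, of the product of a term in
`a`, a term in `b` and a term in `a - b`. -/
def offDiagSum (x y z : (ℕ+ →₀ ℕ) × ℕ) : ℕ → MvPolynomial ℕ+ (RatFunc Fq) :=
  fun d => letI := Classical.decEq (Polynomial Fq)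
    ∑ p ∈ (monicFinset Fq d).offDiag,
      summand Fq x p.1 * summand Fq y p.2 * summand Fq z (p.1 - p.2)

section MonicPolynomials

variable {Fq}

theorem mP_coeff {k : Type} [Field k] (d : ℕ) (c : Fin d → k) (i : Fin d) :
    (mP k d c).coeff i = c i := by
  have hne : (i : ℕ) ≠ d := i.2.ne
  simp [mP, Polynomial.coeff_X_pow, hne, Fin.val_inj]

theorem mP_injective {k : Type} [Field k] (d : ℕ) : Function.Injective (mP k d) := by
  intro c c' h
  ext i
  rw [← mP_coeff d c i, h, mP_coeff]

theorem mem_monicFinset {d : ℕ} {a : Polynomial Fq} :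
    a ∈ monicFinset Fq d ↔ a.Monic ∧ a.natDegree = d := by
  simp only [monicFinset, Finset.mem_image, Finset.mem_univ, true_and]
  constructor
  · rintro ⟨c, rfl⟩
    have hlt := Polynomial.degree_sum_fin_lt c
    refine ⟨Polynomial.monic_X_pow_add hlt, ?_⟩
    apply Polynomial.natDegree_eq_of_degree_eq_some
    rw [mP, Polynomial.degree_add_eq_left_of_degree_lt]
    · simp
    · simpa using hlt
  · rintro ⟨ha, rfl⟩
    refine ⟨fun i => a.coeff i, ?_⟩
    conv_rhs => rw [ha.as_sum]
    rw [mP, Finset.sum_range]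

theorem S1_eq_sum (d : ℕ) (x : (ℕ+ →₀ ℕ) × ℕ) :
    S1 Fq d x.1 x.2 = ∑ a ∈ monicFinset Fq d, summand Fq x a := by
  let := Classical.decEq (Polynomial Fq)
  rw [monicFinset, Finset.sum_image fun _ _ _ _ h => mP_injective d h]
  rfl

theorem ne_zero_of_mem_monicFinset {d : ℕ} {a : Polynomial Fq} (h : a ∈ monicFinset Fq d) :
    a ≠ 0 :=
  (mem_monicFinset.1 h).1.ne_zero

/-- Pairs of distinct monic polynomials `a, b` of degree `d` correspond to the choice of `a`
and of `a - b = l n` with `l` a unit and `n` monic of degree less than `d`. -/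
theorem sum_offDiag_monicFinset {M : Type*} [AddCommMonoid M] [DecidableEq (Polynomial Fq)]
    [Fintype Fqˣ] (d : ℕ) (F : Polynomial Fq → Polynomial Fq → M) :
    ∑ p ∈ (monicFinset Fq d).offDiag, F p.1 (p.1 - p.2) =
      ∑ l : Fqˣ, ∑ a ∈ monicFinset Fq d, ∑ k ∈ Finset.range d, ∑ n ∈ monicFinset Fq k,
        F a (Polynomial.C (l : Fq) * n) := by
  have hR : ∀ (l : Fqˣ) (a : Polynomial Fq),
      ∑ k ∈ Finset.range d, ∑ n ∈ monicFinset Fq k, F a (Polynomial.C (l : Fq) * n) =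
      ∑ n ∈ (Finset.range d).biUnion (monicFinset Fq), F a (Polynomial.C (l : Fq) * n) := by
    intro l a
    rw [Finset.sum_biUnion]
    intro i _ j _ hij
    refine Finset.disjoint_left.2 fun n hi hj => hij ?_
    rw [← (mem_monicFinset.1 hi).2, (mem_monicFinset.1 hj).2]
  simp only [hR]
  simp only [← Finset.sum_product']
  have hmem : ∀ n, n ∈ (Finset.range d).biUnion (monicFinset Fq) ↔
      n.Monic ∧ n.natDegree < d := by
    intro n
    simp only [Finset.mem_biUnion, Finset.mem_range, mem_monicFinset]
    constructor
    · rintro ⟨k, hk, hn, rfl⟩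
      exact ⟨hn, hk⟩
    · rintro ⟨hn, hk⟩
      exact ⟨_, hk, hn, rfl⟩
  symm
  refine Finset.sum_bij (fun r _ => (r.2.1, r.2.1 - Polynomial.C (r.1 : Fq) * r.2.2)) ?_ ?_ ?_ ?_
  · rintro ⟨l, a, n⟩ h
    simp only [Finset.mem_product, Finset.mem_univ, true_and, hmem, mem_monicFinset] at h
    obtain ⟨⟨ha, rfl⟩, hn, hd⟩ := h
    have hlt : (Polynomial.C (l : Fq) * n).degree < a.degree := by
      rw [Polynomial.degree_C_mul l.ne_zero]
      exact Polynomial.degree_lt_degree hd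
    simp only [Finset.mem_offDiag, mem_monicFinset]
    refine ⟨⟨ha, trivial⟩, ⟨ha.sub_of_left hlt, ?_⟩, ?_⟩
    · exact Polynomial.natDegree_eq_of_degree_eq (Polynomial.degree_sub_eq_left_of_degree_lt hlt)
    · intro h
      have h0 : Polynomial.C (l : Fq) * n = 0 := by linear_combination h
      simp [hn.ne_zero] at h0
  · rintro ⟨l, a, n⟩ h ⟨l', a', n'⟩ h' heq
    simp only [Finset.mem_product, Finset.mem_univ, true_and, hmem] at h h'
    simp only [Prod.mk.injEq] at heq
    obtain ⟨rfl, heq⟩ := heq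
    have hmul : Polynomial.C (l : Fq) * n = Polynomial.C (l' : Fq) * n' := by
      linear_combination -heq
    have hl : (l : Fq) = l' := by
      have := congrArg Polynomial.leadingCoeff hmul
      simpa [Polynomial.leadingCoeff_mul, h.2.1.leadingCoeff, h'.2.1.leadingCoeff] using this
    obtain rfl := Units.ext hl
    have hn := mul_left_cancel₀ (by simp) hmul
    rw [hn]
  · rintro ⟨a, b⟩ h
    simp only [Finset.mem_offDiag, mem_monicFinset] at h
    obtain ⟨⟨ha, had⟩, ⟨hb, hbd⟩, hne⟩ := h
    have hsub : a - b ≠ 0 := sub_ne_zero.2 hne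
    have hlc : (a - b).leadingCoeff ≠ 0 := by simpa using hsub
    refine ⟨(Units.mk0 _ hlc, a, Polynomial.C (a - b).leadingCoeff⁻¹ * (a - b)), ?_, ?_⟩
    · simp only [Finset.mem_product, Finset.mem_univ, true_and, hmem, mem_monicFinset]
      refine ⟨⟨ha, had⟩, ?_, ?_⟩
      · simp [Polynomial.Monic, Polynomial.leadingCoeff_mul, hlc]
      · rw [Polynomial.natDegree_C_mul (inv_ne_zero hlc)]
        have hdeg : a.degree = b.degree := by
          rw [Polynomial.degree_eq_natDegree ha.ne_zero, Polynomial.degree_eq_natDegree hb.ne_zero,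
            had, hbd]
        have hlt := Polynomial.degree_sub_lt_left hdeg ha.ne_zero (by rw [ha, hb])
        rw [← had]
        exact Polynomial.natDegree_lt_natDegree hsub hlt
    · simp only [Units.val_mk0, ← mul_assoc, ← Polynomial.C_mul, mul_inv_cancel₀ hlc]
      simp
  · rintro ⟨l, a, n⟩ _
    simp

end MonicPolynomials

section Terms

variable {k : Type} [Field k]

theorem smul_eq_C_FqK_mul (c : k) (f : MvPolynomial ℕ+ (RatFunc k)) :
    c • f = MvPolynomial.C (FqK k c) * f := by
  rw [Algebra.smul_def, IsScalarTower.algebraMap_apply k (RatFunc k), MvPolynomial.algebraMap_eq,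
    IsScalarTower.algebraMap_apply k (Polynomial k) (RatFunc k)]
  rfl

theorem summand_add (x y : (ℕ+ →₀ ℕ) × ℕ) (a : Polynomial k) :
    summand k (x + y) a = summand k x a * summand k y a := by
  have h : chiW k (x.1 + y.1) a = chiW k x.1 a * chiW k y.1 a :=
    Finsupp.prod_add_index' (fun _ => pow_zero _) (fun _ _ _ => pow_add _ _ _)
  simp only [summand, Prod.fst_add, Prod.snd_add, h, pow_add, mul_inv, MvPolynomial.C_mul]
  ring

theorem summand_zero (a : Polynomial k) : summand k 0 a = 1 := by
  simp [summand, chiW]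

theorem summand_single (n : ℕ+) (a : Polynomial k) :
    summand k (Finsupp.single n 1, 0) a = tval k n a := by
  simp [summand, chiW]

theorem summand_single_sub (n : ℕ+) (a b : Polynomial k) :
    summand k (Finsupp.single n 1, 0) (a - b) =
      summand k (Finsupp.single n 1, 0) a - summand k (Finsupp.single n 1, 0) b := by
  simp only [summand_single, tval, Polynomial.eval₂_sub]

/-- The partial fraction identity `1/(ab) = (1/b - 1/a)/(a - b)`. -/
theorem summand_inv_mul (a b : Polynomial k) (ha : a ≠ 0) (hb : b ≠ 0) (hab : a ≠ b) :
    summand k (0, 1) a * summand k (0, 1) b =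
      (summand k (0, 1) b - summand k (0, 1) a) * summand k (0, 1) (a - b) := by
  have hinj := IsFractionRing.injective (Polynomial k) (RatFunc k)
  have ha' : aK k a ≠ 0 := by simpa [aK] using ha
  have hb' : aK k b ≠ 0 := by simpa [aK] using hb
  have hs : aK k (a - b) = aK k a - aK k b := by simp [aK]
  have hab' : aK k a - aK k b ≠ 0 := sub_ne_zero.2 fun h => hab (hinj h)
  simp only [summand, chiW, Finsupp.prod_zero_index, one_mul, pow_one, hs, ← MvPolynomial.C_mul,
    ← MvPolynomial.C_sub]
  congr 1
  field_simp

/-- Scaling the argument of a summand multiplies it by a scalar. -/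
theorem summand_C_mul (x : (ℕ+ →₀ ℕ) × ℕ) (l : k) :
    ∃ c : k, ∀ a, summand k x (Polynomial.C l * a) = c • summand k x a := by
  refine ⟨(x.1.prod fun _ e => l ^ e) * (l ^ x.2)⁻¹, fun a => ?_⟩
  have h1 : ∀ n, tval k n (Polynomial.C l * a) =
      MvPolynomial.C (FqK k l) * tval k n a := by
    intro n
    simp [tval, Polynomial.eval₂_mul]
  have h2 : aK k (Polynomial.C l * a) = FqK k l * aK k a := by
    simp [aK, FqK]
  rw [smul_eq_C_FqK_mul]
  simp only [summand, chiW, h1, h2, mul_pow, Finsupp.prod, Finset.prod_mul_distrib, mul_inv,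
    map_mul, map_inv₀, map_pow, map_prod]
  ring

end Terms

section OffDiag

variable {Fq}

theorem depthOne_mul_truncSum_mem {x : (ℕ+ →₀ ℕ) × ℕ} {L : List ((ℕ+ →₀ ℕ) × ℕ)}
    {g : (ℕ+ →₀ ℕ) × ℕ} (hx : 1 ≤ x.2) (hL : ∀ y ∈ L, 1 ≤ y.2) (hg : x + L.sum = g) :
    depthOne Fq x * truncSum Fq L ∈ powerSpan Fq g :=
  Submodule.subset_span ⟨x, L, List.forall_mem_cons.2 ⟨hx, hL⟩, by simpa using hg, rfl⟩

theorem sum_offDiag_scaled_mem (x z : (ℕ+ →₀ ℕ) × ℕ) (e : Fq) (hx : 1 ≤ x.2) (hz : 1 ≤ z.2) :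
    (fun d => letI := Classical.decEq (Polynomial Fq)
      ∑ p ∈ (monicFinset Fq d).offDiag,
        summand Fq x p.1 * summand Fq z (Polynomial.C e * (p.1 - p.2))) ∈ powerSpan Fq (x + z) := by
  classical
  choose c hc using summand_C_mul (k := Fq) z
  have hkey : (fun d => letI := Classical.decEq (Polynomial Fq)
      ∑ p ∈ (monicFinset Fq d).offDiag,
        summand Fq x p.1 * summand Fq z (Polynomial.C e * (p.1 - p.2))) =
      (∑ l : Fqˣ, c (e * l)) • (depthOne Fq x * truncSum Fq [z]) := by
    ext1 d
    have h := sum_offDiag_monicFinset (Fq := Fq) d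
      fun a f => summand Fq x a * summand Fq z (Polynomial.C e * f)
    simp only [← mul_assoc, ← Polynomial.C_mul, hc, mul_smul_comm, ← Finset.smul_sum,
      ← Finset.mul_sum, ← Finset.sum_mul, ← Finset.sum_smul] at h
    simp only [Pi.smul_apply, Pi.mul_apply, depthOne, truncSum, sumLT, LinearMap.coe_mk,
      AddHom.coe_mk, mul_one, S1_eq_sum]
    simp only [hc, mul_smul_comm, ← Finset.smul_sum] at h ⊢
    convert h using 1
  rw [hkey]
  exact Submodule.smul_mem _ _ (depthOne_mul_truncSum_mem hx (by simpa using hz) (by simp))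

theorem offDiagSum_zero_right_mem (x z : (ℕ+ →₀ ℕ) × ℕ) (hx : 1 ≤ x.2) (hz : 1 ≤ z.2) :
    offDiagSum Fq x 0 z ∈ powerSpan Fq (x + z) := by
  have h := sum_offDiag_scaled_mem (Fq := Fq) x z 1 hx hz
  simp only [Polynomial.C_1, one_mul] at h
  convert h using 1
  ext1 d
  simp only [offDiagSum, summand_zero, mul_one]

theorem offDiagSum_zero_left_mem (y z : (ℕ+ →₀ ℕ) × ℕ) (hy : 1 ≤ y.2) (hz : 1 ≤ z.2) :
    offDiagSum Fq 0 y z ∈ powerSpan Fq (y + z) := by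
  have h := sum_offDiag_scaled_mem (Fq := Fq) y z (-1) hy hz
  convert h using 1
  ext1 d
  simp only [offDiagSum, summand_zero, one_mul]
  refine Finset.sum_nbij' Prod.swap Prod.swap ?_ ?_ ?_ ?_ ?_
  · simp only [Finset.mem_offDiag, Prod.fst_swap, Prod.snd_swap]
    exact fun p hp => ⟨hp.2.1, hp.1, hp.2.2.symm⟩
  · simp only [Finset.mem_offDiag, Prod.fst_swap, Prod.snd_swap]
    exact fun p hp => ⟨hp.2.1, hp.1, hp.2.2.symm⟩
  · simp
  · simp
  · intro p _
    simp

theorem offDiagSum_add_single_right (x y z : (ℕ+ →₀ ℕ) × ℕ) (n : ℕ+) :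
    offDiagSum Fq x (y + (Finsupp.single n 1, 0)) z =
      offDiagSum Fq (x + (Finsupp.single n 1, 0)) y z -
        offDiagSum Fq x y (z + (Finsupp.single n 1, 0)) := by
  ext1 d
  simp only [offDiagSum, Pi.sub_apply, ← Finset.sum_sub_distrib]
  refine Finset.sum_congr rfl fun p _ => ?_
  simp only [summand_add, summand_single_sub]
  ring

theorem offDiagSum_add_inv (x y z : (ℕ+ →₀ ℕ) × ℕ) :
    offDiagSum Fq (x + (0, 1)) (y + (0, 1)) z =
      offDiagSum Fq x (y + (0, 1)) (z + (0, 1)) - offDiagSum Fq (x + (0, 1)) y (z + (0, 1)) := by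
  ext1 d
  simp only [offDiagSum, Pi.sub_apply, ← Finset.sum_sub_distrib]
  refine Finset.sum_congr rfl fun p hp => ?_
  simp only [Finset.mem_offDiag] at hp
  have h := summand_inv_mul p.1 p.2 (ne_zero_of_mem_monicFinset hp.1)
    (ne_zero_of_mem_monicFinset hp.2.1) hp.2.2
  simp only [summand_add]
  linear_combination summand Fq x p.1 * summand Fq y p.2 * summand Fq z (p.1 - p.2) * h

theorem finsupp_nat_induction {P : (ℕ+ →₀ ℕ) → Prop} (zero : P 0)
    (add_single : ∀ s n, P s → P (s + Finsupp.single n 1)) (s : ℕ+ →₀ ℕ) : P s := by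
  suffices h : ∀ s₀, P s₀ → P (s₀ + s) by simpa using h 0 zero
  induction s using Finsupp.induction_linear with
  | zero => simp
  | add f g hf hg => exact fun s₀ h => by simpa [add_assoc] using hg _ (hf _ h)
  | single n k =>
    induction k with
    | zero => simp
    | succ k ih =>
      intro s₀ h
      rw [Finsupp.single_add, ← add_assoc]
      exact add_single _ _ (ih _ h)

theorem offDiagSum_weight_zero_right_mem (s : ℕ+ →₀ ℕ) : ∀ x z : (ℕ+ →₀ ℕ) × ℕ, 1 ≤ x.2 →
    1 ≤ z.2 → offDiagSum Fq x (s, 0) z ∈ powerSpan Fq (x + (s, 0) + z) := by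
  induction s using finsupp_nat_induction with
  | zero =>
    intro x z hx hz
    rw [Prod.mk_zero_zero, add_zero]
    exact offDiagSum_zero_right_mem x z hx hz
  | add_single s n ih =>
    intro x z hx hz
    have hs : ((s + Finsupp.single n 1, 0) : (ℕ+ →₀ ℕ) × ℕ) = (s, 0) + (Finsupp.single n 1, 0) :=
      rfl
    rw [hs, offDiagSum_add_single_right]
    refine Submodule.sub_mem _ ?_ ?_
    · convert ih (x + (Finsupp.single n 1, 0)) z (by simpa using hx) hz using 2
      abel
    · convert ih x (z + (Finsupp.single n 1, 0)) hx (by simpa using hz) using 2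
      abel

theorem offDiagSum_weight_zero_left_mem (s : ℕ+ →₀ ℕ) : ∀ y z : (ℕ+ →₀ ℕ) × ℕ, 1 ≤ y.2 →
    1 ≤ z.2 → offDiagSum Fq (s, 0) y z ∈ powerSpan Fq ((s, 0) + y + z) := by
  induction s using finsupp_nat_induction with
  | zero =>
    intro y z hy hz
    rw [Prod.mk_zero_zero, zero_add]
    exact offDiagSum_zero_left_mem y z hy hz
  | add_single s n ih =>
    intro y z hy hz
    have hs : ((s + Finsupp.single n 1, 0) : (ℕ+ →₀ ℕ) × ℕ) = (s, 0) + (Finsupp.single n 1, 0) :=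
      rfl
    rw [hs, sub_eq_iff_eq_add.1 (offDiagSum_add_single_right (s, 0) y z n).symm]
    refine Submodule.add_mem _ ?_ ?_
    · convert ih (y + (Finsupp.single n 1, 0)) z (by simpa using hy) hz using 2
      abel
    · convert ih y (z + (Finsupp.single n 1, 0)) hy (by simpa using hz) using 2
      abel

theorem offDiagSum_mem (s t : ℕ+ →₀ ℕ) : ∀ (i j : ℕ) (z : (ℕ+ →₀ ℕ) × ℕ), 1 ≤ i + j →
    1 ≤ z.2 ∨ (1 ≤ i ∧ 1 ≤ j) →
    offDiagSum Fq (s, i) (t, j) z ∈ powerSpan Fq ((s, i) + (t, j) + z)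
  | i, 0, z, hij, h => offDiagSum_weight_zero_right_mem t (s, i) z hij (by omega)
  | 0, j + 1, z, _, h => offDiagSum_weight_zero_left_mem s (t, j + 1) z (by simp) (by omega)
  | i + 1, j + 1, z, _, _ => by
    have hi : ((s, i + 1) : (ℕ+ →₀ ℕ) × ℕ) = (s, i) + (0, 1) := by simp
    have hj : ((t, j + 1) : (ℕ+ →₀ ℕ) × ℕ) = (t, j) + (0, 1) := by simp
    have h₁ := offDiagSum_mem s t i (j + 1) (z + (0, 1)) (by omega) (by simp)
    have h₂ := offDiagSum_mem s t (i + 1) j (z + (0, 1)) (by omega) (by simp)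
    rw [hi, hj] at *
    rw [offDiagSum_add_inv]
    refine Submodule.sub_mem _ ?_ ?_
    · convert h₁ using 2
      abel
    · convert h₂ using 2
      abel

/-- The product of two depth-one power sums. -/
theorem depthOne_mul_depthOne_mem (x y : (ℕ+ →₀ ℕ) × ℕ) (hx : 1 ≤ x.2) (hy : 1 ≤ y.2) :
    depthOne Fq x * depthOne Fq y ∈ powerSpan Fq (x + y) := by
  classical
  have h : depthOne Fq x * depthOne Fq y =
      depthOne Fq (x + y) * truncSum Fq [] + offDiagSum Fq x y 0 := by
    ext1 d
    simp only [Pi.mul_apply, Pi.add_apply, truncSum, mul_one, depthOne, S1_eq_sum,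
      offDiagSum, summand_zero, summand_add]
    rw [Finset.sum_mul_sum, ← Finset.sum_product', ← Finset.diag_union_offDiag,
      Finset.sum_union (Finset.disjoint_diag_offDiag _), Finset.sum_diag]
  rw [h]
  refine Submodule.add_mem _ (depthOne_mul_truncSum_mem (by simp; omega) (by simp) (by simp)) ?_
  simpa using offDiagSum_mem x.1 y.1 x.2 y.2 0 (by omega) (Or.inr ⟨hx, hy⟩)

end OffDiag

section Stuffle

variable {Fq}

theorem SP_cons (x : (ℕ+ →₀ ℕ) × ℕ) (L : List ((ℕ+ →₀ ℕ) × ℕ)) :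
    SP Fq (x :: L) = depthOne Fq x * truncSum Fq L := by
  induction L generalizing x with
  | nil => ext1 d; simp [SP, depthOne, truncSum]
  | cons y L ih =>
    ext1 d
    rw [SP, ih]
    rfl

theorem sumLT_mem {g : (ℕ+ →₀ ℕ) × ℕ} {f : ℕ → MvPolynomial ℕ+ (RatFunc Fq)}
    (hf : f ∈ powerSpan Fq g) : sumLT Fq f ∈ truncSpan Fq g := by
  induction hf using Submodule.span_induction with
  | mem f hf =>
    obtain ⟨x, L, hL, hg, rfl⟩ := hf
    exact Submodule.subset_span ⟨x :: L, hL, hg, rfl⟩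
  | zero => simp
  | add f g _ _ hf hg => rw [map_add]; exact Submodule.add_mem _ hf hg
  | smul c f _ hf => rw [map_smul]; exact Submodule.smul_mem _ _ hf

theorem depthOne_mul_mem {x g : (ℕ+ →₀ ℕ) × ℕ} {f : ℕ → MvPolynomial ℕ+ (RatFunc Fq)}
    (hx : 1 ≤ x.2) (hf : f ∈ truncSpan Fq g) : depthOne Fq x * f ∈ powerSpan Fq (x + g) := by
  induction hf using Submodule.span_induction with
  | mem f hf =>
    obtain ⟨L, hL, hg, rfl⟩ := hf
    exact depthOne_mul_truncSum_mem hx hL (by rw [hg])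
  | zero => simp
  | add f g _ _ hf hg => rw [mul_add]; exact Submodule.add_mem _ hf hg
  | smul c f _ hf => rw [mul_smul_comm]; exact Submodule.smul_mem _ _ hf

theorem sumLT_mul_sumLT {F : Type} [Field F] (f g : ℕ → MvPolynomial ℕ+ (RatFunc F)) :
    sumLT F f * sumLT F g = sumLT F (f * sumLT F g + sumLT F f * g + f * g) := by
  ext1 d
  simp only [sumLT, LinearMap.coe_mk, AddHom.coe_mk, Pi.mul_apply, Pi.add_apply]
  induction d with
  | zero => simp
  | succ d ih =>
    simp only [Finset.sum_range_succ] at ih ⊢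
    rw [← ih]
    ring

/-- If truncated sums of weight at most `n` multiply as expected, then so do an element of a
power span and a truncated sum, of total weight at most `n + 1`. -/
theorem powerSpan_mul_truncSpan {n : ℕ}
    (hmul : ∀ X Y : List ((ℕ+ →₀ ℕ) × ℕ), (∀ x ∈ X, 1 ≤ x.2) → (∀ y ∈ Y, 1 ≤ y.2) →
      (X.sum + Y.sum).2 ≤ n → truncSum Fq X * truncSum Fq Y ∈ truncSpan Fq (X.sum + Y.sum))
    {g h : (ℕ+ →₀ ℕ) × ℕ} (hgh : (g + h).2 ≤ n + 1) {e f : ℕ → MvPolynomial ℕ+ (RatFunc Fq)}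
    (he : e ∈ powerSpan Fq g) (hf : f ∈ truncSpan Fq h) : e * f ∈ powerSpan Fq (g + h) := by
  induction he using Submodule.span_induction with
  | mem e he =>
    obtain ⟨x, L, hL, rfl, rfl⟩ := he
    have hx : 1 ≤ x.2 := hL x (by simp)
    rw [mul_assoc, List.sum_cons, add_assoc]
    refine depthOne_mul_mem hx ?_
    induction hf using Submodule.span_induction with
    | mem f hf =>
      obtain ⟨Y, hY, rfl, rfl⟩ := hf
      refine hmul L Y (fun y hy => hL y (by simp [hy])) hY ?_
      simp only [List.sum_cons, Prod.snd_add] at hgh ⊢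
      omega
    | zero => simp
    | add f g _ _ hf hg => rw [mul_add]; exact Submodule.add_mem _ hf hg
    | smul c f _ hf => rw [mul_smul_comm]; exact Submodule.smul_mem _ _ hf
  | zero => simp
  | add f g _ _ hf hg => rw [add_mul]; exact Submodule.add_mem _ hf hg
  | smul c f _ hf => rw [smul_mul_assoc]; exact Submodule.smul_mem _ _ hf

theorem truncSum_mem {L : List ((ℕ+ →₀ ℕ) × ℕ)} (hL : ∀ x ∈ L, 1 ≤ x.2) :
    truncSum Fq L ∈ truncSpan Fq L.sum :=
  Submodule.subset_span ⟨L, hL, rfl, rfl⟩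

theorem truncSum_mul_truncSum_mem (n : ℕ) : ∀ X Y : List ((ℕ+ →₀ ℕ) × ℕ), (∀ x ∈ X, 1 ≤ x.2) →
    (∀ y ∈ Y, 1 ≤ y.2) → (X.sum + Y.sum).2 ≤ n →
    truncSum Fq X * truncSum Fq Y ∈ truncSpan Fq (X.sum + Y.sum) := by
  induction n with
  | zero =>
    rintro (_ | ⟨x, X⟩) Y hX hY hn
    · simpa [truncSum] using truncSum_mem hY
    · have := hX x (by simp)
      simp only [List.sum_cons, Prod.snd_add] at hn
      omega
  | succ n ih =>
    rintro (_ | ⟨x, X⟩) (_ | ⟨y, Y⟩) hX hY hn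
    · simpa [truncSum] using truncSum_mem hX
    · simpa [truncSum] using truncSum_mem hY
    · simpa [truncSum] using truncSum_mem hX
    · have hx : 1 ≤ x.2 := hX x (by simp)
      have hy : 1 ≤ y.2 := hY y (by simp)
      have hX' : ∀ x ∈ X, 1 ≤ x.2 := fun z hz => hX z (by simp [hz])
      have hY' : ∀ y ∈ Y, 1 ≤ y.2 := fun z hz => hY z (by simp [hz])
      simp only [List.sum_cons, Prod.snd_add] at hn
      have hXY := ih X Y hX' hY' (by simp only [Prod.snd_add]; omega)
      have h₁ := ih X (y :: Y) hX' hY (by simp only [List.sum_cons, Prod.snd_add]; omega)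
      have h₂ := ih (x :: X) Y hX hY' (by simp only [List.sum_cons, Prod.snd_add]; omega)
      simp only [truncSum, List.sum_cons] at h₁ h₂ ⊢
      rw [sumLT_mul_sumLT]
      refine sumLT_mem (Submodule.add_mem _ (Submodule.add_mem _ ?_ ?_) ?_)
      · rw [mul_assoc, add_assoc]
        exact depthOne_mul_mem hx h₁
      · rw [mul_left_comm, add_left_comm]
        exact depthOne_mul_mem hy h₂
      · rw [mul_mul_mul_comm, add_add_add_comm]
        refine powerSpan_mul_truncSpan ih ?_ (depthOne_mul_depthOne_mem x y hx hy) hXY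
        simp only [Prod.snd_add]
        omega

theorem SP_mul_SP_mem {x y : (ℕ+ →₀ ℕ) × ℕ} {X Y : List ((ℕ+ →₀ ℕ) × ℕ)}
    (hX : ∀ z ∈ x :: X, 1 ≤ z.2) (hY : ∀ z ∈ y :: Y, 1 ≤ z.2) :
    SP Fq (x :: X) * SP Fq (y :: Y) ∈ powerSpan Fq ((x :: X).sum + (y :: Y).sum) := by
  rw [SP_cons, SP_cons, mul_mul_mul_comm, List.sum_cons, List.sum_cons, add_add_add_comm]
  exact powerSpan_mul_truncSpan (truncSum_mul_truncSum_mem _) (Nat.le_succ _)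
    (depthOne_mul_depthOne_mem x y (hX x (by simp)) (hY y (by simp)))
    (truncSum_mul_truncSum_mem _ X Y (fun z hz => hX z (by simp [hz]))
      (fun z hz => hY z (by simp [hz])) le_rfl)

end Stuffle

theorem isCompW_iff (L : List ((ℕ+ →₀ ℕ) × ℕ)) (Sg : ℕ+ →₀ ℕ) (w : ℕ) :
    IsCompW L Sg w ↔ (∀ x ∈ L, 1 ≤ x.2) ∧ L.sum = (Sg, w) := by
  have h₁ : (L.map Prod.fst).sum = L.sum.1 := (map_list_sum (AddMonoidHom.fst _ _) L).symm
  have h₂ : (L.map Prod.snd).sum = L.sum.2 := (map_list_sum (AddMonoidHom.snd _ _) L).symm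
  rw [IsCompW, h₁, h₂, Prod.ext_iff]

theorem statement5 (Sg1 Sg2 : ℕ+ →₀ ℕ) (w1 w2 : ℕ) (hw1 : 1 ≤ w1) (hw2 : 1 ≤ w2)
    (A B : List ((ℕ+ →₀ ℕ) × ℕ)) (hA : IsCompW A Sg1 w1) (hB : IsCompW B Sg2 w2) :
    ∃ (m : ℕ) (α : Fin m → Fq) (Cs : Fin m → List ((ℕ+ →₀ ℕ) × ℕ)),
      (∀ i, IsCompW (Cs i) (Sg1 + Sg2) (w1 + w2)) ∧
      ∀ d : ℕ, SP Fq A d * SP Fq B d =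
        ∑ i, MvPolynomial.C (FqK Fq (α i)) * SP Fq (Cs i) d := by
  rw [isCompW_iff] at hA hB
  obtain ⟨hA, hAs⟩ := hA
  obtain ⟨hB, hBs⟩ := hB
  cases A with
  | nil => simp [Prod.ext_iff] at hAs; omega
  | cons x X =>
  cases B with
  | nil => simp [Prod.ext_iff] at hBs; omega
  | cons y Y =>
  have h := SP_mul_SP_mem (Fq := Fq) hA hB
  rw [hAs, hBs, powerSpan, Submodule.mem_span_set'] at h
  obtain ⟨m, α, f, hf⟩ := h
  choose u L hpos hsum hfun using fun i => (f i).2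
  refine ⟨m, α, fun i => u i :: L i, fun i => (isCompW_iff _ _ _).2 ⟨hpos i, hsum i⟩, fun d => ?_⟩
  have hd := congrFun hf d
  rw [Pi.mul_apply] at hd
  rw [← hd, Finset.sum_apply]
  refine Finset.sum_congr rfl fun i _ => ?_
  rw [SP_cons, hfun, ← smul_eq_C_FqK_mul, Pi.smul_apply]

end
end

section
/- For every integer d ≥ 1, one has the identity P_d(t, θ^d) = t^d − b_d(t) in the polynomial ring K[t]; equivalently, Σ_{j=0}^{d−1} b_j(t) · E_j(θ^d) = t^d − b_d(t). -/
/-!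
STATEMENT 8: For every integer `d ≥ 1`, in the polynomial ring `K[t]` with
`K = F_q(θ)`, one has `P_d(t, θ^d) = t^d − b_d(t)`, i.e.
`Σ_{j=0}^{d−1} b_j(t)·E_j(θ^d) = t^d − b_d(t)`, where
`b_j(t) = ∏_{i<j}(t − θ^{q^i})`, `D_j = ∏_{i<j}(θ^{q^j} − θ^{q^i})` and
`E_j(x) = D_j⁻¹ ∏_{a ∈ A_<(j)} (x + a)` (so `E_0(x) = x`).
-/

open Polynomial Finset

noncomputable section

variable (Fq : Type) [Field Fq] [Fintype Fq]

/-- `q`, the cardinality of the base field. -/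
abbrev q := Fintype.card Fq

/-- `θ` as an element of `K = F_q(θ)`. -/
def th : RatFunc Fq := algebraMap (Polynomial Fq) (RatFunc Fq) Polynomial.X

/-- The polynomial `Σ_{i<d} c_i θ^i`; as `c` ranges over `Fin d → Fq` these are
exactly the elements of `A_<(d)`. -/
def lP (d : ℕ) (c : Fin d → Fq) : Polynomial Fq :=
  ∑ i : Fin d, Polynomial.C (c i) * Polynomial.X ^ (i : ℕ)

/-- `D_d = ∏_{i<d} (θ^{q^d} − θ^{q^i})`, with `D_0 = 1`. -/
def Dd (d : ℕ) : RatFunc Fq := ∏ i ∈ Finset.range d, (th Fq ^ q Fq ^ d - th Fq ^ q Fq ^ i)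

/-- `ℓ_d = ∏_{i=1}^{d} (θ − θ^{q^i})`, with `ℓ_0 = 1`. -/
def ld (d : ℕ) : RatFunc Fq := ∏ i ∈ Finset.Icc 1 d, (th Fq - th Fq ^ q Fq ^ i)

/-- `E_d(x) = D_d⁻¹ ∏_{a ∈ A_<(d)} (x + a)` (for `d = 0` this gives `E_0(x) = x`). -/
def Ed (d : ℕ) (x : RatFunc Fq) : RatFunc Fq :=
  (Dd Fq d)⁻¹ * ∏ c : Fin d → Fq, (x + aK Fq (lP Fq d c))

/-- `b_d(t) = ∏_{i<d} (t − θ^{q^i})` as a polynomial in `t` over `K`, with `b_0 = 1`. -/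
def bp (d : ℕ) : Polynomial (RatFunc Fq) :=
  ∏ i ∈ Finset.range d, (Polynomial.X - Polynomial.C (th Fq ^ q Fq ^ i))

/-- `∏_{a ∈ A_<(d)} (x + a)`, the numerator of `E_d(x)`. -/
def prodLT (d : ℕ) (x : RatFunc Fq) : RatFunc Fq :=
  ∏ c : Fin d → Fq, (x + aK Fq (lP Fq d c))

lemma X_pow_card_sub_X_eq_prod :
    (X ^ q Fq - X : Fq[X]) = ∏ c : Fq, (X - C c) := by
  have hmonic : (X ^ q Fq - X : Fq[X]).Monic :=
    monic_X_pow_sub (by rw [degree_X]; exact_mod_cast Fintype.one_lt_card)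
  have hroots := FiniteField.roots_X_pow_card_sub_X Fq
  have hprod := prod_multiset_X_sub_C_of_monic_of_roots_card_eq hmonic (by
    rw [hroots, FiniteField.X_pow_card_sub_X_natDegree_eq Fq Fintype.one_lt_card]
    rfl)
  rw [hroots] at hprod
  exact hprod.symm

variable {Fq} in
lemma prod_add_algebraMap_mul {L : Type*} [Field L] [Algebra Fq L] (u v : L) :
    ∏ c : Fq, (u + algebraMap Fq L c * v) = u ^ q Fq - v ^ (q Fq - 1) * u := by
  have hq : 1 < q Fq := Fintype.one_lt_card
  rcases eq_or_ne v 0 with rfl | hv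
  · simp [zero_pow (Nat.sub_pos_of_lt hq).ne']
  have hmonic : ∏ c : Fq, (u / v + algebraMap Fq L c) = (u / v) ^ q Fq - u / v := by
    have h := congrArg (aeval (u / v)) (X_pow_card_sub_X_eq_prod Fq)
    simp only [map_sub, map_pow, aeval_X, map_prod, aeval_C] at h
    rw [h, ← Equiv.prod_comp (Equiv.neg Fq)]
    simp [sub_eq_add_neg]
  have hfactor : ∀ c : Fq, u + algebraMap Fq L c * v = v * (u / v + algebraMap Fq L c) := by
    intro c
    field_simp
  rw [prod_congr rfl fun c _ => hfactor c, prod_mul_distrib, hmonic, prod_const, card_univ]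
  have hsucc : v ^ q Fq = v ^ (q Fq - 1) * v := by
    rw [← pow_succ, Nat.sub_add_cancel hq.le]
  rw [mul_sub, ← mul_pow, mul_div_cancel₀ _ hv, hsucc, mul_assoc, mul_div_cancel₀ _ hv]

lemma prodLT_succ_eq_prod (d : ℕ) (x : RatFunc Fq) :
    prodLT Fq (d + 1) x = ∏ c : Fq, prodLT Fq d (x + algebraMap Fq _ c * th Fq ^ d) := by
  unfold prodLT
  rw [← (Fin.snocEquiv fun _ : Fin (d + 1) => Fq).prod_comp, Fintype.prod_prod_type]
  refine prod_congr rfl fun c _ => prod_congr rfl fun a _ => ?_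
  simp only [aK, lP, th, Fin.snocEquiv_apply, Fin.sum_univ_castSucc, Fin.snoc_castSucc,
    Fin.snoc_last, Fin.val_castSucc, Fin.val_last, map_add, map_mul, map_pow]
  rw [show algebraMap Fq[X] (RatFunc Fq) (C c) = algebraMap Fq (RatFunc Fq) c from
    (IsScalarTower.algebraMap_apply Fq Fq[X] (RatFunc Fq) c).symm]
  ring

lemma card_add_pow (x y : RatFunc Fq) : (x + y) ^ q Fq = x ^ q Fq + y ^ q Fq :=
  map_add (FiniteField.frobeniusAlgHom Fq (RatFunc Fq)) x y

lemma card_sub_pow (x y : RatFunc Fq) : (x - y) ^ q Fq = x ^ q Fq - y ^ q Fq :=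
  map_sub (FiniteField.frobeniusAlgHom Fq (RatFunc Fq)) x y

lemma card_sum_pow {ι : Type*} (s : Finset ι) (f : ι → RatFunc Fq) :
    (∑ i ∈ s, f i) ^ q Fq = ∑ i ∈ s, f i ^ q Fq :=
  map_sum (FiniteField.frobeniusAlgHom Fq (RatFunc Fq)) f s

lemma algebraMap_pow_card (c : Fq) :
    algebraMap Fq (RatFunc Fq) c ^ q Fq = algebraMap Fq (RatFunc Fq) c := by
  rw [← map_pow, FiniteField.pow_card]

/-- `prodLT Fq d` is `F_q`-linear. -/
lemma prodLT_linear (d : ℕ) : ∀ (x y : RatFunc Fq) (c : Fq),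
    prodLT Fq d (x + algebraMap Fq _ c * y) =
      prodLT Fq d x + algebraMap Fq _ c * prodLT Fq d y := by
  induction d with
  | zero => simp [prodLT, aK, lP]
  | succ d ih =>
    intro x y c
    simp only [prodLT_succ_eq_prod, ih, prod_add_algebraMap_mul, card_add_pow, mul_pow,
      algebraMap_pow_card]
    ring

lemma prodLT_succ (d : ℕ) (x : RatFunc Fq) :
    prodLT Fq (d + 1) x =
      prodLT Fq d x ^ q Fq - prodLT Fq d (th Fq ^ d) ^ (q Fq - 1) * prodLT Fq d x := by
  simp only [prodLT_succ_eq_prod, prodLT_linear, prod_add_algebraMap_mul]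

lemma th_pow_card_pow_injective : Function.Injective fun i : ℕ => th Fq ^ q Fq ^ i := by
  intro m n h
  simp only [th, ← map_pow] at h
  apply Nat.pow_right_injective (Fintype.one_lt_card : 1 < q Fq)
  simpa using congrArg natDegree (RatFunc.algebraMap_injective Fq h)

lemma Dd_ne_zero (d : ℕ) : Dd Fq d ≠ 0 := by
  refine prod_ne_zero_iff.2 fun i hi => sub_ne_zero.2 fun h => ?_
  exact (mem_range.1 hi).ne' (th_pow_card_pow_injective Fq h)

lemma Dd_succ (d : ℕ) :
    Dd Fq (d + 1) = Dd Fq d ^ q Fq * (th Fq ^ q Fq ^ (d + 1) - th Fq) := by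
  simp only [Dd, prod_range_succ', ← prod_pow, card_sub_pow, ← pow_mul, ← pow_succ, pow_zero,
    pow_one]

lemma Ed_eq (d : ℕ) (x : RatFunc Fq) : Ed Fq d x = (Dd Fq d)⁻¹ * prodLT Fq d x := rfl

lemma prodLT_eq (d : ℕ) (x : RatFunc Fq) : prodLT Fq d x = Dd Fq d * Ed Fq d x := by
  rw [Ed_eq, mul_inv_cancel_left₀ (Dd_ne_zero Fq d)]

lemma Ed_zero (x : RatFunc Fq) : Ed Fq 0 x = x := by
  simp [Ed, Dd, aK, lP]

lemma Ed_pow_card (d : ℕ) (h : Ed Fq d (th Fq ^ d) = 1) (x : RatFunc Fq) :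
    Ed Fq d x ^ q Fq = Ed Fq d x + (th Fq ^ q Fq ^ (d + 1) - th Fq) * Ed Fq (d + 1) x := by
  have hrec := prodLT_succ Fq d x
  simp only [prodLT_eq, h, mul_one, Dd_succ] at hrec
  have hsucc : Dd Fq d ^ q Fq = Dd Fq d ^ (q Fq - 1) * Dd Fq d := by
    rw [← pow_succ, Nat.sub_add_cancel Fintype.card_pos]
  apply mul_left_cancel₀ (pow_ne_zero (q Fq) (Dd_ne_zero Fq d))
  rw [mul_pow] at hrec
  linear_combination -hrec - Ed Fq d x * hsucc

lemma eval_bp (j : ℕ) (s : RatFunc Fq) :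
    (bp Fq j).eval s = ∏ i ∈ range j, (s - th Fq ^ q Fq ^ i) := by
  simp [bp, eval_prod]

lemma eval_bp_eq_zero {j k : ℕ} (h : k < j) : (bp Fq j).eval (th Fq ^ q Fq ^ k) = 0 := by
  rw [eval_bp]
  exact prod_eq_zero (mem_range.2 h) (sub_self _)

lemma eval_bp_succ (j : ℕ) (s : RatFunc Fq) :
    (bp Fq (j + 1)).eval (s ^ q Fq) = (s ^ q Fq - th Fq) * (bp Fq j).eval s ^ q Fq := by
  simp only [eval_bp, prod_range_succ', ← prod_pow, card_sub_pow, ← pow_mul, ← pow_succ, pow_zero,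
    pow_one]
  ring

lemma eval_bp_succ_pow_card (j : ℕ) (s : RatFunc Fq) :
    (bp Fq (j + 1)).eval s ^ q Fq =
      (bp Fq j).eval s ^ q Fq * (s ^ q Fq - th Fq ^ q Fq ^ (j + 1)) := by
  simp only [eval_bp, prod_range_succ, mul_pow, card_sub_pow, ← pow_mul, ← pow_succ]

lemma bp_natDegree (j : ℕ) : (bp Fq j).natDegree = j := by
  simp only [bp, natDegree_finsetProd_X_sub_C_eq_card, card_range]

lemma bp_monic (j : ℕ) : (bp Fq j).Monic :=
  monic_prod_of_monic _ _ fun _ _ => monic_X_sub_C _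

/-- Raising the partial sums to the `q`-th power, given `E_j(θ^j) = 1` for `j < k`. -/
lemma sum_eval_bp_mul_Ed_pow_card (k : ℕ) (s x : RatFunc Fq)
    (h : ∀ j < k, Ed Fq j (th Fq ^ j) = 1) :
    (∑ j ∈ range k, (bp Fq j).eval s * Ed Fq j x) ^ q Fq +
        (bp Fq k).eval s ^ q Fq * Ed Fq k x =
      ∑ j ∈ range (k + 1), (bp Fq j).eval (s ^ q Fq) * Ed Fq j x := by
  induction k with
  | zero => simp [bp, zero_pow Fintype.card_ne_zero]
  | succ k ih =>
    have hk := ih fun j hj => h j (hj.trans k.lt_succ_self)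
    rw [sum_range_succ _ (k + 1), ← hk, sum_range_succ, card_add_pow, mul_pow,
      Ed_pow_card Fq k (h k k.lt_succ_self), eval_bp_succ, eval_bp_succ_pow_card]
    ring

/-- Carlitz's expansion of `x^{q^k}` in the `E_j(x)`. -/
lemma sum_eval_bp_mul_Ed (k : ℕ) (x : RatFunc Fq) (h : ∀ j < k, Ed Fq j (th Fq ^ j) = 1) :
    ∑ j ∈ range (k + 1), (bp Fq j).eval (th Fq ^ q Fq ^ k) * Ed Fq j x = x ^ q Fq ^ k := by
  induction k with
  | zero => simp [bp, Ed_zero]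
  | succ k ih =>
    have hk := ih fun j hj => h j (hj.trans k.lt_succ_self)
    have hsum := sum_eval_bp_mul_Ed_pow_card Fq (k + 1) (th Fq ^ q Fq ^ k) x h
    rw [eval_bp_eq_zero Fq k.lt_succ_self, zero_pow Fintype.card_ne_zero, zero_mul, add_zero, hk,
      ← pow_mul, ← pow_mul, ← pow_succ] at hsum
    exact hsum.symm

lemma sum_bp_mul_Ed_of_lt (d : ℕ) (h : ∀ j < d, Ed Fq j (th Fq ^ j) = 1) :
    ∑ j ∈ range (d + 1), bp Fq j * C (Ed Fq j (th Fq ^ d)) = X ^ d := by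
  refine eq_of_degrees_lt_of_eval_index_eq (range (d + 1))
    (th_pow_card_pow_injective Fq).injOn ?_ ?_ fun k hk => ?_
  · rw [card_range, ← mem_degreeLT]
    refine Submodule.sum_mem _ fun j hj => mem_degreeLT.2 ?_
    refine (degree_le_of_natDegree_le (n := j) ?_).trans_lt ?_
    · exact (natDegree_mul_C_le _ _).trans (bp_natDegree Fq j).le
    · exact_mod_cast mem_range.1 hj
  · rw [card_range, degree_X_pow]
    exact_mod_cast d.lt_succ_self
  · have hkd : k ≤ d := Nat.lt_succ_iff.1 (mem_range.1 hk)
    simp only [eval_finsetSum, eval_mul, eval_C, eval_pow, eval_X]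
    rw [pow_right_comm,
      ← sum_eval_bp_mul_Ed Fq k (th Fq ^ d) fun j hj => h j (hj.trans_le hkd)]
    symm
    refine sum_subset (range_mono (Nat.succ_le_succ hkd)) fun j _ hj => ?_
    rw [eval_bp_eq_zero Fq (by simpa using hj), zero_mul]

/-- `∏ (θ^d + a) = D_d`, the product of all monic polynomials of degree `d`. -/
lemma Ed_th_pow_self (d : ℕ) : Ed Fq d (th Fq ^ d) = 1 := by
  induction d using Nat.strong_induction_on with
  | _ d ih =>
    have h := congrArg (coeff · d) (sum_bp_mul_Ed_of_lt Fq d ih)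
    simp only [finsetSum_coeff, coeff_mul_C, coeff_X_pow_self] at h
    have hlead : (bp Fq d).coeff d = 1 := by
      simpa [bp_natDegree] using (bp_monic Fq d).coeff_natDegree
    rwa [sum_range_succ, sum_eq_zero, zero_add, hlead, one_mul] at h
    intro j hj
    rw [coeff_eq_zero_of_natDegree_lt, zero_mul]
    rw [bp_natDegree]
    exact mem_range.1 hj

theorem statement8 (d : ℕ) (hd : 1 ≤ d) :
    ∑ j ∈ Finset.range d, bp Fq j * Polynomial.C (Ed Fq j (th Fq ^ d)) =
      Polynomial.X ^ d - bp Fq d := by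
  rw [eq_sub_iff_add_eq, ← sum_bp_mul_Ed_of_lt Fq d fun j _ => Ed_th_pow_self Fq j,
    sum_range_succ, Ed_th_pow_self, C_1, mul_one]

end
end

section
/- For every integer d ≥ 1, one has Σ_{j=0}^{d−1} b_j(t)/ℓ_j = b_d(t)/(ℓ_{d−1} (t − θ)) in the field K(t); equivalently, Q_{d,0}(t) = b_d(t)/(ℓ_{d−1}(t − θ)). -/
/-!
STATEMENT 9: For every integer `d ≥ 1`, in the field `K(t)` of rational
functions over `K = F_q(θ)`, one has
`Σ_{j=0}^{d−1} b_j(t)/ℓ_j = b_d(t)/(ℓ_{d−1}(t − θ))`, i.e.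
`Q_{d,0}(t) = b_d(t)/(ℓ_{d−1}(t − θ))`, where `b_j(t) = ∏_{i<j}(t − θ^{q^i})`
and `ℓ_j = ∏_{i=1}^{j}(θ − θ^{q^i})`.
-/

open Polynomial Finset

noncomputable section

variable (Fq : Type) [Field Fq] [Fintype Fq]

/-- The field `K(t)` of rational functions in `t` over `K`. -/
abbrev Kt := RatFunc (RatFunc Fq)

/-- The inclusion `K[t] → K(t)`. -/
def toKt : Polynomial (RatFunc Fq) →+* Kt Fq :=
  algebraMap (Polynomial (RatFunc Fq)) (Kt Fq)

theorem toKt_injective : Function.Injective (toKt Fq) :=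
  IsFractionRing.injective (Polynomial (RatFunc Fq)) (Kt Fq)

theorem th_sub_th_pow_ne_zero {i : ℕ} (hi : i ≠ 0) : th Fq - th Fq ^ q Fq ^ i ≠ 0 := by
  intro h
  have hX : (X : Polynomial Fq) ^ 1 = X ^ q Fq ^ i := by
    apply IsFractionRing.injective (Polynomial Fq) (RatFunc Fq)
    simpa [th] using sub_eq_zero.mp h
  have hdeg := congrArg natDegree hX
  rw [natDegree_X_pow, natDegree_X_pow] at hdeg
  exact (Nat.one_lt_pow hi Fintype.one_lt_card).ne hdeg

theorem ld_succ (d : ℕ) : ld Fq (d + 1) = ld Fq d * (th Fq - th Fq ^ q Fq ^ (d + 1)) :=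
  Finset.prod_Icc_succ_top (Nat.le_add_left 1 d) _

theorem ld_ne_zero (d : ℕ) : ld Fq d ≠ 0 :=
  Finset.prod_ne_zero_iff.mpr fun _ hi =>
    th_sub_th_pow_ne_zero Fq (Nat.one_le_iff_ne_zero.mp (Finset.mem_Icc.mp hi).1)

theorem bp_succ (d : ℕ) : bp Fq (d + 1) = bp Fq d * (X - C (th Fq ^ q Fq ^ d)) :=
  Finset.prod_range_succ _ _

theorem toKt_C_ne_zero {a : RatFunc Fq} (ha : a ≠ 0) : toKt Fq (C a) ≠ 0 :=
  (map_ne_zero_iff _ (toKt_injective Fq)).mpr (C_ne_zero.mpr ha)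

theorem toKt_X_sub_toKt_C_ne_zero (a : RatFunc Fq) : toKt Fq X - toKt Fq (C a) ≠ 0 := by
  rw [← map_sub]
  exact (map_ne_zero_iff _ (toKt_injective Fq)).mpr (X_sub_C_ne_zero a)

theorem statement9 (d : ℕ) (hd : 1 ≤ d) :
    ∑ j ∈ Finset.range d, toKt Fq (bp Fq j) / toKt Fq (Polynomial.C (ld Fq j)) =
      toKt Fq (bp Fq d) /
        (toKt Fq (Polynomial.C (ld Fq (d - 1))) *
          (toKt Fq Polynomial.X - toKt Fq (Polynomial.C (th Fq)))) := by
  obtain ⟨n, rfl⟩ := Nat.exists_eq_add_of_le' hd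
  clear hd
  rw [Nat.add_sub_cancel]
  have ht := toKt_X_sub_toKt_C_ne_zero Fq (th Fq)
  induction n with
  | zero => simp [bp, ld, div_self ht]
  | succ n ih =>
    have hl := toKt_C_ne_zero Fq (ld_ne_zero Fq n)
    have hs := toKt_C_ne_zero Fq (th_sub_th_pow_ne_zero Fq n.succ_ne_zero)
    rw [Finset.sum_range_succ, ih, bp_succ Fq (n + 1), ld_succ]
    simp only [map_mul, map_sub] at hs ⊢
    field_simp
    ring

end
end

section
/- Let Σ be a finite subset of ℕ* with |Σ| < q and let d ≥ 1. Then, in the field of rational functions over K(t_i : i ∈ Σ) in the variable x, one has Σ_{a∈A^+(d)} ( ∏_{i∈Σ} a(t_i) )/(a − x) = ( ∏_{i∈Σ} ( P_d(t_i, x) + b_d(t_i) ) ) / ( ℓ_d ( 1 − E_d(x) ) ). -/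
/-!
STATEMENT 10: Let `Σ` be a finite subset of `ℕ*` with `|Σ| < q` and `d ≥ 1`.
In the field of rational functions over `K = F_q(θ)` in the variable `x` and
the variables `t_i` (realized as the fraction field of the polynomial ring over
`K` in the variables indexed by `Option ℕ+`, with `x` the variable `none` and
`t_i` the variable `some i`), one has
`Σ_{a ∈ A^+(d)} (∏_{i∈Σ} a(t_i))/(a − x)
   = (∏_{i∈Σ} (P_d(t_i,x) + b_d(t_i))) / (ℓ_d (1 − E_d(x)))`,
where `b_j(t) = ∏_{m<j}(t − θ^{q^m})`, `ℓ_d = ∏_{i=1}^{d}(θ − θ^{q^i})`,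
`D_j = ∏_{i<j}(θ^{q^j} − θ^{q^i})`, `E_j(x) = D_j⁻¹ ∏_{a∈A_<(j)}(x+a)` and
`P_d(t,x) = Σ_{j<d} b_j(t) E_j(x)`.
-/

open Polynomial Finset

noncomputable section

variable (Fq : Type) [Field Fq] [Fintype Fq]

/-- The field `K(x, t_i : i ∈ ℕ*)`: the variable `none` is `x`, the variable
`some i` is `t_i`. -/
abbrev BF := FractionRing (MvPolynomial (Option ℕ+) (RatFunc Fq))

/-- The inclusion of the polynomial ring into the rational function field. -/
def toBF : MvPolynomial (Option ℕ+) (RatFunc Fq) →+* BF Fq :=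
  algebraMap (MvPolynomial (Option ℕ+) (RatFunc Fq)) (BF Fq)

/-- The inclusion `K → K(x, t_i : i)`. -/
def KtoBF : RatFunc Fq →+* BF Fq :=
  (toBF Fq).comp (MvPolynomial.C : RatFunc Fq →+* MvPolynomial (Option ℕ+) (RatFunc Fq))

/-- The variable `x`. -/
def xv : BF Fq := toBF Fq (MvPolynomial.X none)

/-- The variable `t_i`. -/
def tv (i : ℕ+) : BF Fq := toBF Fq (MvPolynomial.X (some i))

/-- `a(t_i)`: substitute `θ` by `t_i` in `a ∈ A`. -/
def chit (i : ℕ+) (a : Polynomial Fq) : BF Fq :=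
  Polynomial.eval₂ ((KtoBF Fq).comp (FqK Fq)) (tv Fq i) a

/-- `b_j(u) = ∏_{m<j} (u − θ^{q^m})`, evaluated at any element `u`. -/
def bF (j : ℕ) (u : BF Fq) : BF Fq := ∏ m ∈ Finset.range j, (u - KtoBF Fq (th Fq) ^ q Fq ^ m)

/-- `E_j(x) = D_j⁻¹ ∏_{a ∈ A_<(j)} (x + a)` (so `E_0(x) = x`). -/
def EF (j : ℕ) (x : BF Fq) : BF Fq :=
  (KtoBF Fq (Dd Fq j))⁻¹ * ∏ c : Fin j → Fq, (x + KtoBF Fq (aK Fq (lP Fq j c)))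

/-- `P_d(t,x) = Σ_{j<d} b_j(t) E_j(x)`. -/
def PF (d : ℕ) (t x : BF Fq) : BF Fq := ∑ j ∈ Finset.range d, bF Fq j t * EF Fq j x

section Specialization

variable {F : Type} {L : Type*} [Field F] [Field L] [Algebra F L]

lemma aeval_mP_eq (y : L) (d : ℕ) (c : Fin d → F) :
    aeval y (mP F d c) = y ^ d + ∑ i : Fin d, c i • y ^ (i : ℕ) := by
  simp [mP, Algebra.smul_def]

lemma aeval_lP_eq (y : L) (d : ℕ) (c : Fin d → F) :
    aeval y (lP F d c) = ∑ i : Fin d, c i • y ^ (i : ℕ) := by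
  simp [lP, Algebra.smul_def]

lemma aeval_mP_injective {θ : L} (hθ : Transcendental F θ) (d : ℕ) :
    Function.Injective fun c : Fin d → F => aeval θ (mP F d c) := by
  intro c c' h
  have h' := add_left_cancel (transcendental_iff_injective.mp hθ h)
  funext k
  simpa [finsetSum_coeff, coeff_X_pow, Fin.val_inj] using congrArg (coeff · (k : ℕ)) h'

end Specialization

section CarlitzPolynomials

variable (F : Type) {L : Type*} [Fintype F] [Field L]

/-- The polynomials defined by `g_0 = X` and
`(θ^{q^{j+1}} - θ) g_{j+1} = g_j^q - g_j`, which turn out to be Carlitz's `E_j`. -/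
def carlitzPoly (θ : L) : ℕ → L[X]
  | 0 => X
  | j + 1 => C (θ ^ Fintype.card F ^ (j + 1) - θ)⁻¹ *
      (carlitzPoly θ j ^ Fintype.card F - carlitzPoly θ j)

/-- The normalising factor `D_j`, as an element of a field containing `θ`. -/
def carlitzFactor (θ : L) (j : ℕ) : L :=
  ∏ i ∈ Finset.range j, (θ ^ Fintype.card F ^ j - θ ^ Fintype.card F ^ i)

lemma pow_fieldCard_pow_succ (θ : L) (j : ℕ) :
    θ ^ Fintype.card F ^ (j + 1) = (θ ^ Fintype.card F ^ j) ^ Fintype.card F := by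
  rw [pow_succ, pow_mul]

lemma carlitzPoly_eval_succ (θ x : L) (j : ℕ) :
    (carlitzPoly F θ (j + 1)).eval x = (θ ^ Fintype.card F ^ (j + 1) - θ)⁻¹ *
      ((carlitzPoly F θ j).eval x ^ Fintype.card F - (carlitzPoly F θ j).eval x) := by
  simp [carlitzPoly]

variable [Field F] [Algebra F L]

lemma add_pow_fieldCard {R : Type*} [CommRing R] [Algebra F R] (x y : R) :
    (x + y) ^ Fintype.card F = x ^ Fintype.card F + y ^ Fintype.card F :=
  map_add (FiniteField.frobeniusAlgHom F R) x y

lemma sub_pow_fieldCard {R : Type*} [CommRing R] [Algebra F R] (x y : R) :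
    (x - y) ^ Fintype.card F = x ^ Fintype.card F - y ^ Fintype.card F :=
  map_sub (FiniteField.frobeniusAlgHom F R) x y

lemma smul_pow_fieldCard {R : Type*} [CommRing R] [Algebra F R] (c : F) (x : R) :
    (c • x) ^ Fintype.card F = c • x ^ Fintype.card F :=
  map_smul (FiniteField.frobeniusAlgHom F R) c x

lemma carlitzPoly_eval_add (θ x y : L) (j : ℕ) :
    (carlitzPoly F θ j).eval (x + y) =
      (carlitzPoly F θ j).eval x + (carlitzPoly F θ j).eval y := by
  induction j with
  | zero => simp [carlitzPoly]
  | succ j ih =>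
    simp only [carlitzPoly_eval_succ, ih, add_pow_fieldCard F]
    ring

lemma carlitzPoly_eval_smul (θ : L) (c : F) (x : L) (j : ℕ) :
    (carlitzPoly F θ j).eval (c • x) = c • (carlitzPoly F θ j).eval x := by
  induction j with
  | zero => simp [carlitzPoly]
  | succ j ih =>
    simp only [carlitzPoly_eval_succ, ih, smul_pow_fieldCard F]
    rw [← smul_sub, mul_smul_comm]

/-- Evaluation of `carlitzPoly` as an `F`-linear map. -/
def carlitzMap (θ : L) (j : ℕ) : L →ₗ[F] L where
  toFun x := (carlitzPoly F θ j).eval x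
  map_add' x y := carlitzPoly_eval_add F θ x y j
  map_smul' c x := carlitzPoly_eval_smul F θ c x j

@[simp] lemma carlitzMap_apply (θ x : L) (j : ℕ) :
    carlitzMap F θ j x = (carlitzPoly F θ j).eval x := rfl

variable {F} {θ : L}

lemma pow_fieldCard_sub_ne_zero (hθ : Transcendental F θ) {i j : ℕ} (h : i ≠ j) :
    θ ^ Fintype.card F ^ i - θ ^ Fintype.card F ^ j ≠ 0 := by
  intro h0
  have hinj := transcendental_iff_injective.mp hθ
  have : (X : F[X]) ^ Fintype.card F ^ i = X ^ Fintype.card F ^ j :=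
    hinj (by simpa using sub_eq_zero.mp h0)
  have h2 := congrArg natDegree this
  simp only [natDegree_X_pow] at h2
  exact h (Nat.pow_right_injective Fintype.one_lt_card h2)

lemma pow_fieldCard_succ_sub_ne_zero (hθ : Transcendental F θ) (j : ℕ) :
    θ ^ Fintype.card F ^ (j + 1) - θ ≠ 0 := by
  simpa using pow_fieldCard_sub_ne_zero hθ (Nat.succ_ne_zero j)

lemma carlitzPoly_eval_succ_theta_mul (hθ : Transcendental F θ) (x : L) (j : ℕ) :
    (carlitzPoly F θ (j + 1)).eval (θ * x) =
      θ ^ Fintype.card F ^ (j + 1) * (carlitzPoly F θ (j + 1)).eval x +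
        (carlitzPoly F θ j).eval x := by
  induction j with
  | zero =>
    have h := pow_fieldCard_succ_sub_ne_zero hθ 0
    rw [zero_add, pow_one] at h
    rw [carlitzPoly_eval_succ, carlitzPoly_eval_succ]
    simp only [carlitzPoly, eval_X, zero_add, pow_one, mul_pow]
    field_simp
    ring
  | succ j ih =>
    have h := pow_fieldCard_succ_sub_ne_zero hθ (j + 1)
    have h' := pow_fieldCard_succ_sub_ne_zero hθ j
    have e := carlitzPoly_eval_succ F θ x j
    rw [eq_inv_mul_iff_mul_eq₀ h'] at e
    rw [carlitzPoly_eval_succ F θ (θ * x), ih, carlitzPoly_eval_succ F θ x (j + 1),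
      add_pow_fieldCard F, mul_pow, ← pow_fieldCard_pow_succ]
    rw [inv_mul_eq_iff_eq_mul₀ h, mul_add, mul_left_comm, mul_inv_cancel_left₀ h]
    linear_combination -e

lemma carlitzPoly_eval_theta_pow (hθ : Transcendental F θ) (m j : ℕ) (hmj : m ≤ j) :
    (carlitzPoly F θ j).eval (θ ^ m) = if m = j then 1 else 0 := by
  induction m generalizing j with
  | zero =>
    induction j with
    | zero => simp [carlitzPoly]
    | succ j ih =>
      rw [carlitzPoly_eval_succ, ih (Nat.zero_le _)]
      have : Fintype.card F ≠ 0 := Fintype.card_ne_zero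
      split_ifs <;> simp_all
  | succ m ih =>
    obtain ⟨j, rfl⟩ : ∃ k, j = k + 1 := ⟨j - 1, by omega⟩
    rw [pow_succ', carlitzPoly_eval_succ_theta_mul hθ, ih _ (by omega), ih _ (by omega),
      if_neg (by omega : m ≠ j + 1)]
    simp

lemma bprod_sum_eval_theta_pow (hθ : Transcendental F θ) (t : L) (m d : ℕ) (hmd : m ≤ d) :
    ∑ j ∈ Finset.range (d + 1), (∏ k ∈ Finset.range j, (t - θ ^ Fintype.card F ^ k)) *
      (carlitzPoly F θ j).eval (θ ^ m) = t ^ m := by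
  induction m with
  | zero =>
    rw [Finset.sum_range_succ', Finset.sum_eq_zero]
    · simp [carlitzPoly]
    · intro j _
      rw [carlitzPoly_eval_theta_pow hθ _ _ (Nat.zero_le _)]
      simp
  | succ m ih =>
    have key : ∀ n : ℕ, ∑ j ∈ Finset.range (n + 1),
        (∏ k ∈ Finset.range j, (t - θ ^ Fintype.card F ^ k)) *
          (carlitzPoly F θ j).eval (θ ^ (m + 1)) =
        t * ∑ j ∈ Finset.range (n + 1),
          (∏ k ∈ Finset.range j, (t - θ ^ Fintype.card F ^ k)) *
            (carlitzPoly F θ j).eval (θ ^ m) -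
        (∏ k ∈ Finset.range (n + 1), (t - θ ^ Fintype.card F ^ k)) *
          (carlitzPoly F θ n).eval (θ ^ m) := by
      intro n
      induction n with
      | zero => simp [carlitzPoly]; ring
      | succ n ihn =>
        rw [Finset.sum_range_succ, ihn, Finset.sum_range_succ _ (n + 1), pow_succ',
          carlitzPoly_eval_succ_theta_mul hθ, Finset.prod_range_succ _ (n + 1)]
        ring
    rw [key, ih (by omega), carlitzPoly_eval_theta_pow hθ m d (by omega), if_neg (by omega)]
    ring

lemma natDegree_carlitzPoly (hθ : Transcendental F θ) (j : ℕ) :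
    (carlitzPoly F θ j).natDegree = Fintype.card F ^ j := by
  induction j with
  | zero => simp [carlitzPoly]
  | succ j ih =>
    rw [carlitzPoly, natDegree_C_mul (inv_ne_zero (pow_fieldCard_succ_sub_ne_zero hθ j)),
      natDegree_sub_eq_left_of_natDegree_lt, natDegree_pow, ih, pow_succ']
    rw [natDegree_pow, ih, ← pow_succ']
    exact Nat.pow_lt_pow_right Fintype.one_lt_card (Nat.lt_succ_self j)

lemma carlitzFactor_succ (j : ℕ) :
    carlitzFactor F θ (j + 1) =
      (θ ^ Fintype.card F ^ (j + 1) - θ) * carlitzFactor F θ j ^ Fintype.card F := by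
  rw [carlitzFactor, Finset.prod_range_succ', mul_comm, carlitzFactor, ← Finset.prod_pow]
  simp [sub_pow_fieldCard F, ← pow_mul, ← pow_succ]

lemma carlitzFactor_ne_zero (hθ : Transcendental F θ) (j : ℕ) : carlitzFactor F θ j ≠ 0 :=
  Finset.prod_ne_zero_iff.mpr fun _ hi =>
    pow_fieldCard_sub_ne_zero hθ (Finset.mem_range.mp hi).ne'

lemma leadingCoeff_carlitzPoly (hθ : Transcendental F θ) (j : ℕ) :
    (carlitzPoly F θ j).leadingCoeff = (carlitzFactor F θ j)⁻¹ := by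
  induction j with
  | zero => simp [carlitzPoly, carlitzFactor]
  | succ j ih =>
    rw [carlitzPoly, leadingCoeff_mul, leadingCoeff_C, leadingCoeff_sub_of_degree_lt,
      leadingCoeff_pow, ih, carlitzFactor_succ, mul_inv, inv_pow]
    apply degree_lt_degree
    rw [natDegree_pow, natDegree_carlitzPoly hθ, ← pow_succ']
    exact Nat.pow_lt_pow_right Fintype.one_lt_card (Nat.lt_succ_self j)

lemma derivative_carlitzPoly (j : ℕ) :
    derivative (carlitzPoly F θ j) =
      C (∏ i ∈ Finset.Icc 1 j, (θ - θ ^ Fintype.card F ^ i))⁻¹ := by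
  induction j with
  | zero => simp [carlitzPoly]
  | succ j ih =>
    have hq : (Fintype.card F : L[X]) = 0 := by
      rw [← map_natCast (algebraMap F L[X]), FiniteField.cast_card_eq_zero, map_zero]
    rw [carlitzPoly, derivative_C_mul, derivative_sub, derivative_pow, C_eq_natCast, hq, ih,
      Finset.prod_Icc_succ_top (by omega), mul_inv, mul_comm _⁻¹, C_mul, ← neg_sub θ,
      inv_neg, C_neg]
    ring

lemma carlitzPoly_eval_aeval_mP (hθ : Transcendental F θ) (d : ℕ) (c : Fin d → F) :
    (carlitzPoly F θ d).eval (aeval θ (mP F d c)) = 1 := by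
  rw [← carlitzMap_apply, aeval_mP_eq, map_add, map_sum, Finset.sum_eq_zero]
  · simp [carlitzPoly_eval_theta_pow hθ d d le_rfl]
  · intro i _
    rw [map_smul, carlitzMap_apply, carlitzPoly_eval_theta_pow hθ _ _ i.2.le,
      if_neg i.2.ne, smul_zero]

/-- Carlitz's expansion `a(t) = ∑_{j ≤ d} b_j(t) E_j(a)` for `a` monic of degree `d`. -/
lemma bprod_sum_eval_aeval_mP (hθ : Transcendental F θ) (t : L) (d : ℕ) (c : Fin d → F) :
    ∑ j ∈ Finset.range (d + 1), (∏ k ∈ Finset.range j, (t - θ ^ Fintype.card F ^ k)) *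
      (carlitzPoly F θ j).eval (aeval θ (mP F d c)) = aeval t (mP F d c) := by
  rw [aeval_mP_eq t, ← bprod_sum_eval_theta_pow hθ t d d le_rfl]
  simp_rw [fun i : Fin d => (bprod_sum_eval_theta_pow hθ t i d i.2.le).symm, Finset.smul_sum]
  rw [Finset.sum_comm, ← Finset.sum_add_distrib]
  refine Finset.sum_congr rfl fun j _ => ?_
  simp_rw [← carlitzMap_apply, aeval_mP_eq, map_add, map_sum, map_smul, mul_add, Finset.mul_sum,
    mul_smul_comm]

lemma nodal_aeval_mP (hθ : Transcendental F θ) (d : ℕ) :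
    Lagrange.nodal Finset.univ (fun c : Fin d → F => aeval θ (mP F d c)) =
      C (carlitzFactor F θ d) * (carlitzPoly F θ d - 1) := by
  have hD := carlitzFactor_ne_zero hθ d
  have hpos : 0 < Fintype.card F ^ d := pow_pos Fintype.card_pos d
  have hlt : (1 : L[X]).degree < (carlitzPoly F θ d).degree :=
    degree_lt_degree (by rwa [natDegree_one, natDegree_carlitzPoly hθ])
  have hmonic : (C (carlitzFactor F θ d) * (carlitzPoly F θ d - 1)).leadingCoeff = 1 := by
    rw [leadingCoeff_mul, leadingCoeff_C, leadingCoeff_sub_of_degree_lt hlt,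
      leadingCoeff_carlitzPoly hθ, mul_inv_cancel₀ hD]
  refine eq_of_degree_le_of_eval_index_eq Finset.univ (aeval_mP_injective hθ d).injOn
    Lagrange.degree_nodal.le ?_ ?_ ?_
  · rw [Lagrange.degree_nodal, degree_C_mul hD, degree_sub_eq_left_of_degree_lt hlt,
      degree_eq_natDegree (by rintro h; simp [h] at hlt), natDegree_carlitzPoly hθ]
    simp
  · rw [hmonic]
    exact Lagrange.nodal_monic
  · intro c hc
    rw [Lagrange.eval_nodal_at_node (v := fun c : Fin d → F => aeval θ (mP F d c)) hc]
    simp [carlitzPoly_eval_aeval_mP hθ]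

lemma prod_sub_aeval_mP (hθ : Transcendental F θ) (d : ℕ) (x : L) :
    ∏ c : Fin d → F, (x - aeval θ (mP F d c)) =
      carlitzFactor F θ d * ((carlitzPoly F θ d).eval x - 1) := by
  rw [← Lagrange.eval_nodal, nodal_aeval_mP hθ]
  simp

lemma prod_add_aeval_lP (hθ : Transcendental F θ) (d : ℕ) (x : L) :
    ∏ c : Fin d → F, (x + aeval θ (lP F d c)) =
      carlitzFactor F θ d * (carlitzPoly F θ d).eval x := by
  have h := prod_sub_aeval_mP hθ d (x + θ ^ d)
  rw [carlitzPoly_eval_add, carlitzPoly_eval_theta_pow hθ d d le_rfl, if_pos rfl,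
    add_sub_cancel_right, ← Equiv.prod_comp (Equiv.neg (Fin d → F))] at h
  rw [← h]
  refine Finset.prod_congr rfl fun c _ => ?_
  simp only [aeval_mP_eq, aeval_lP_eq, Equiv.neg_apply, Pi.neg_apply, neg_smul,
    Finset.sum_neg_distrib]
  ring

/-- Lagrange interpolation at the monic polynomials of degree `d`. -/
lemma sum_eval_div_aeval_mP_sub (hθ : Transcendental F θ) {d : ℕ} {x : L}
    (hx : ∀ c : Fin d → F, x ≠ aeval θ (mP F d c)) {f : L[X]}
    (hf : f.natDegree < Fintype.card F ^ d) :
    ∑ c : Fin d → F, f.eval (aeval θ (mP F d c)) / (aeval θ (mP F d c) - x) =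
      f.eval x / ((∏ i ∈ Finset.Icc 1 d, (θ - θ ^ Fintype.card F ^ i)) *
        (1 - (carlitzPoly F θ d).eval x)) := by
  classical
  have hD := carlitzFactor_ne_zero hθ d
  have hl : ∏ i ∈ Finset.Icc 1 d, (θ - θ ^ Fintype.card F ^ i) ≠ 0 :=
    Finset.prod_ne_zero_iff.mpr fun i hi => by
      simpa using pow_fieldCard_sub_ne_zero hθ (i := 0) (j := i)
        (by have := (Finset.mem_Icc.mp hi).1; omega)
  have hE : 1 - (carlitzPoly F θ d).eval x ≠ 0 := by
    have h := prod_sub_aeval_mP hθ d x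
    intro h0
    rw [← neg_sub, h0, neg_zero, mul_zero, Finset.prod_eq_zero_iff] at h
    obtain ⟨c, -, hc⟩ := h
    exact hx c (sub_eq_zero.mp hc)
  have hdeg : f.degree < #(Finset.univ : Finset (Fin d → F)) := by
    refine degree_le_natDegree.trans_lt ?_
    simpa using mod_cast hf
  have h := congrArg (eval x)
    (Lagrange.eq_interpolate (aeval_mP_injective hθ d).injOn hdeg)
  rw [Lagrange.eval_interpolate_not_at_node _ fun c _ => hx c] at h
  simp only [fun c : Fin d → F => Lagrange.nodalWeight_eq_eval_derivative_nodal
    (v := fun c : Fin d → F => aeval θ (mP F d c)) (Finset.mem_univ c)] at h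
  simp only [nodal_aeval_mP hθ, derivative_C_mul, derivative_sub, derivative_one, sub_zero,
    derivative_carlitzPoly, eval_mul, eval_C, eval_sub, eval_one, mul_assoc,
    ← Finset.mul_sum] at h
  rw [h, eq_div_iff (mul_ne_zero hl hE)]
  have hs : ∑ c : Fin d → F, f.eval (aeval θ (mP F d c)) / (aeval θ (mP F d c) - x) =
      -∑ c : Fin d → F, (x - aeval θ (mP F d c))⁻¹ * f.eval (aeval θ (mP F d c)) := by
    rw [← Finset.sum_neg_distrib]
    refine Finset.sum_congr rfl fun c _ => ?_
    rw [div_eq_mul_inv, ← neg_sub x, inv_neg]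
    ring
  rw [hs]
  field_simp
  ring

theorem sum_prod_aeval_div_aeval_mP_sub (hθ : Transcendental F θ) {ι : Type*} (s : Finset ι)
    (t : ι → L) (hs : #s < Fintype.card F) {d : ℕ} (hd : 1 ≤ d) {x : L}
    (hx : ∀ c : Fin d → F, x ≠ aeval θ (mP F d c)) :
    ∑ c : Fin d → F, (∏ i ∈ s, aeval (t i) (mP F d c)) / (aeval θ (mP F d c) - x) =
      (∏ i ∈ s, (∑ j ∈ Finset.range d, (∏ k ∈ Finset.range j, (t i - θ ^ Fintype.card F ^ k)) *
          (carlitzPoly F θ j).eval x + ∏ k ∈ Finset.range d, (t i - θ ^ Fintype.card F ^ k))) /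
        ((∏ i ∈ Finset.Icc 1 d, (θ - θ ^ Fintype.card F ^ i)) *
          (1 - (carlitzPoly F θ d).eval x)) := by
  set b : ℕ → L → L := fun j u => ∏ k ∈ Finset.range j, (u - θ ^ Fintype.card F ^ k) with hb
  set f : L[X] := ∏ i ∈ s,
    (∑ j ∈ Finset.range d, C (b j (t i)) * carlitzPoly F θ j + C (b d (t i))) with hf
  have hfx (y : L) : f.eval y = ∏ i ∈ s,
      (∑ j ∈ Finset.range d, b j (t i) * (carlitzPoly F θ j).eval y + b d (t i)) := by
    simp [hf, eval_prod, eval_finsetSum]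
  have hdeg : f.natDegree < Fintype.card F ^ d := by
    calc f.natDegree ≤ ∑ i ∈ s, Fintype.card F ^ (d - 1) := by
          refine (natDegree_prod_le _ _).trans (Finset.sum_le_sum fun i _ => ?_)
          rw [natDegree_add_C]
          refine natDegree_sum_le_of_forall_le _ _ fun j hj => ?_
          refine (natDegree_C_mul_le _ _).trans ?_
          rw [natDegree_carlitzPoly hθ]
          exact Nat.pow_le_pow_right Fintype.card_pos
            (by have := Finset.mem_range.mp hj; omega)
      _ = #s * Fintype.card F ^ (d - 1) := by simp
      _ < Fintype.card F * Fintype.card F ^ (d - 1) :=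
          Nat.mul_lt_mul_of_pos_right hs (pow_pos Fintype.card_pos _)
      _ = Fintype.card F ^ d := by rw [← pow_succ', Nat.sub_add_cancel hd]
  rw [← hfx, ← sum_eval_div_aeval_mP_sub hθ hx hdeg]
  refine Finset.sum_congr rfl fun c _ => ?_
  rw [hfx]
  congr 1
  refine Finset.prod_congr rfl fun i _ => ?_
  rw [← bprod_sum_eval_aeval_mP hθ (t i) d c, Finset.sum_range_succ,
    carlitzPoly_eval_aeval_mP hθ, mul_one]

end CarlitzPolynomials

section RationalFunctionField

variable (F : Type) [Field F]

lemma algebraMap_BF_eq : algebraMap F (BF F) = (KtoBF F).comp (FqK F) := by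
  ext a
  simp only [KtoBF, FqK, toBF, RingHom.comp_apply]
  rw [IsScalarTower.algebraMap_apply F (MvPolynomial (Option ℕ+) (RatFunc F)) (BF F),
    MvPolynomial.algebraMap_apply]
  rfl

lemma KtoBF_aK (a : F[X]) : KtoBF F (aK F a) = aeval (KtoBF F (th F)) a := by
  rw [aeval_def, algebraMap_BF_eq, aK, th, ← RingHom.comp_apply, ← RingHom.comp_apply]
  conv_lhs => rw [← eval₂_C_X (p := a), hom_eval₂]
  rfl

lemma chit_eq_aeval (i : ℕ+) (a : F[X]) : chit F i a = aeval (tv F i) a := by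
  rw [aeval_def, algebraMap_BF_eq, chit]

lemma transcendental_KtoBF_th : Transcendental F (KtoBF F (th F)) := by
  rw [transcendental_iff_injective]
  intro a b h
  rw [← KtoBF_aK, ← KtoBF_aK] at h
  exact IsFractionRing.injective F[X] (RatFunc F) ((KtoBF F).injective h)

lemma xv_ne_KtoBF (k : RatFunc F) : xv F ≠ KtoBF F k := by
  intro h
  have h' : (MvPolynomial.X none : MvPolynomial (Option ℕ+) (RatFunc F)) = MvPolynomial.C k :=
    IsFractionRing.injective (MvPolynomial (Option ℕ+) (RatFunc F)) (BF F) h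
  simpa using congrArg MvPolynomial.totalDegree h'

end RationalFunctionField

lemma KtoBF_Dd (j : ℕ) : KtoBF Fq (Dd Fq j) = carlitzFactor Fq (KtoBF Fq (th Fq)) j := by
  simp [Dd, carlitzFactor]

lemma EF_eq_eval_carlitzPoly (j : ℕ) (x : BF Fq) :
    EF Fq j x = (carlitzPoly Fq (KtoBF Fq (th Fq)) j).eval x := by
  have hθ := transcendental_KtoBF_th Fq
  simp only [EF, KtoBF_aK, KtoBF_Dd]
  rw [prod_add_aeval_lP hθ, inv_mul_cancel_left₀ (carlitzFactor_ne_zero hθ j)]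

theorem statement10 (Sg : Finset ℕ+) (hSg : Sg.card < q Fq) (d : ℕ) (hd : 1 ≤ d) :
    ∑ c : Fin d → Fq, (∏ i ∈ Sg, chit Fq i (mP Fq d c)) /
        (KtoBF Fq (aK Fq (mP Fq d c)) - xv Fq) =
      (∏ i ∈ Sg, (PF Fq d (tv Fq i) (xv Fq) + bF Fq d (tv Fq i))) /
        (KtoBF Fq (ld Fq d) * (1 - EF Fq d (xv Fq))) := by
  have h := sum_prod_aeval_div_aeval_mP_sub (transcendental_KtoBF_th Fq) Sg (tv Fq) hSg hd
    (x := xv Fq) fun c => by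
      rw [← KtoBF_aK]
      exact xv_ne_KtoBF Fq _
  simpa only [chit_eq_aeval, KtoBF_aK, PF, bF, EF_eq_eval_carlitzPoly, ld, map_prod, map_sub,
    map_pow] using h

end
end
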